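/- If n > 7 is an integer, 2n is a G number, and p is an odd prime with p < n such that p1(n) is the smallest prime factor of g((n-1)^2, p), then p = p1(n). -/

import Mathlib

/-- `g x m = x + 2m - ((x - m) mod 2m)`. -/
def g (x m : ℕ) : ℕ := x + 2 * m - (x - m) % (2 * m)

/-- `p1 n` is the maximum of the smallest prime factor of `g ((n-1)^2) p`
taken over all odd primes `p ≤ n`. -/
def p1 (n : ℕ) : ℕ :=
  ((Finset.range (n + 1)).filter (fun p => p.Prime ∧ Odd p)).sup
    (fun p => Nat.minFac (g ((n - 1) ^ 2) p))

/-- The even number `2n` is a G number if `g ((n-1)^2) (p1 n) = p1 n * (2n - p1 n)`. -/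
def IsGNumber (n : ℕ) : Prop :=
  g ((n - 1) ^ 2) (p1 n) = p1 n * (2 * n - p1 n)

theorem g_spec (x m : ℕ) (hm : 0 < m) (h : m ≤ x) :
    x < g x m ∧ g x m ≤ x + 2 * m ∧ ∃ k, g x m = m * (2 * k + 1) := by
  unfold g
  have h1 := Nat.mod_lt (x - m) (show 0 < 2 * m by omega)
  have h2 := Nat.div_add_mod (x - m) (2 * m)
  refine ⟨by omega, by omega, (x - m) / (2 * m) + 1, ?_⟩
  have h3 : m * (2 * ((x - m) / (2 * m) + 1) + 1)
      = 2 * m * ((x - m) / (2 * m)) + 3 * m := by ring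
  rw [h3]
  omega

theorem stmt_19 (n p : ℕ) (hn : 7 < n) (hG : IsGNumber n) (hp : Nat.Prime p)
    (hodd : Odd p) (hpn : p < n)
    (hmin : p1 n = Nat.minFac (g ((n - 1) ^ 2) p)) : p = p1 n := by
  unfold IsGNumber at hG
  generalize p1 n = q at *
  obtain ⟨t, rfl⟩ : ∃ t, n = t + 1 := ⟨n - 1, by omega⟩
  simp only [Nat.add_sub_cancel] at *
  have hpx : p ≤ t ^ 2 := by nlinarith
  obtain ⟨a1, a2, k, a3⟩ := g_spec (t ^ 2) p hp.pos hpx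
  have hpd : p ∣ g (t ^ 2) p := ⟨_, a3⟩
  have hqp : q ≤ p := hmin ▸ Nat.minFac_le_of_dvd hp.two_le hpd
  have hq : q.Prime := by
    rw [hmin]; apply Nat.minFac_prime; nlinarith
  have hqd : q ∣ g (t ^ 2) p := hmin ▸ Nat.minFac_dvd _
  obtain ⟨b1, b2, -⟩ := g_spec (t ^ 2) q hq.pos (hqp.trans hpx)
  rw [hG] at b1 b2
  by_contra hne
  have hlt : q < p := by omega
  have hcop : Nat.Coprime p q := (Nat.coprime_primes hp hq).2 hne
  obtain ⟨c, hc⟩ := hcop.mul_dvd_of_dvd_of_dvd hpd hqd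
  have hoddN : Odd (g (t ^ 2) p) := by
    rw [a3]; exact hodd.mul ⟨k, rfl⟩
  have hco : Odd c := by
    rw [hc] at hoddN; exact (Nat.odd_mul.1 hoddN).2
  obtain ⟨d, ht⟩ : ∃ d, t + 1 = q + d := ⟨t + 1 - q, by omega⟩
  have e : 2 * (t + 1) - q = t + 1 + d := by omega
  rw [e] at b1 b2
  clear hG hmin e
  rw [hc] at a1 a2
  obtain ⟨j, rfl⟩ := hco
  rcases Nat.eq_zero_or_pos j with rfl | hj
  · -- c = 1
    have : q * (p + 2) > q * (t + 1 + d) := by nlinarith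
    have := lt_of_mul_lt_mul_left this (Nat.zero_le _)
    omega
  · have h3 : p * q * 3 ≤ p * q * (2 * j + 1) := Nat.mul_le_mul_left _ (by omega)
    have h4 : p * q * 3 ≤ t ^ 2 + 2 * t := by omega
    have hd : d * d + 1 < 2 * (t + 1) := by
      zify at b1 ht ⊢
      have : (q : ℤ) = t + 1 - d := by linarith
      rw [this] at b1
      nlinarith
    have h5 : (q + 1) * q * 3 ≤ t ^ 2 + 2 * t := by nlinarith
    rcases Nat.lt_or_ge t 9 with h9 | h9
    · have : d ≤ 4 := by nlinarith
      have : t = 7 ∨ t = 8 := by omega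
      rcases this with rfl | rfl
      · have : d ≤ 3 := by nlinarith
        have : 5 ≤ q := by omega
        nlinarith
      · have : 5 ≤ q := by omega
        nlinarith
    · have h6 : 5 * d ≤ 2 * (t + 1) := by
        rcases Nat.lt_or_ge d 5 with h | h
        · omega
        · nlinarith
      have h7 : 3 * (t + 1) ≤ 5 * q := by omega
      have h8 := Nat.mul_le_mul h7 h7
      clear * - h8 h5
      nlinarith
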